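/- arXiv:2605.16013 — 4 statements merged into one kernel-verified Lean document; each statement's English description precedes it below -/
import Mathlib

section
/- Let f : ℝ → ℝ be a function with f(t) ≥ 0 for all t ≥ 1, and suppose there exist constants C > 0 and d ≥ 0 such that f(t) ≤ C·t^d for all t ≥ 1. Then for every real N ≥ 1 there exists a real M ≥ N such that f(2M) ≤ (2^d + 1)·f(M). -/
/-- If `f` grows by a factor of at least `K ≥ 0` under each doubling beyond `a ≥ 0`, then it grows
at least geometrically along the dyadic multiples of `a`. -/
theorem pow_mul_le_of_doubling_lower_bound {f : ℝ → ℝ} {K a : ℝ} (hK : 0 ≤ K) (ha : 0 ≤ a)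
    (h : ∀ t, a ≤ t → K * f t ≤ f (2 * t)) (k : ℕ) :
    K ^ k * f a ≤ f (2 ^ k * a) := by
  induction k with
  | zero => simp
  | succ k ih =>
    have hscale : a ≤ 2 ^ k * a := le_mul_of_one_le_left ha (one_le_pow₀ one_le_two)
    calc K ^ (k + 1) * f a = K * (K ^ k * f a) := by ring
      _ ≤ K * f (2 ^ k * a) := mul_le_mul_of_nonneg_left ih hK
      _ ≤ f (2 * (2 ^ k * a)) := h _ hscale
      _ = f (2 ^ (k + 1) * a) := by ring_nf

/-- A nonnegative function on `[1, ∞)` of polynomial growth of order `d`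
admits doubling at arbitrarily large scales with doubling constant `2 ^ d + 1`. -/
theorem polynomial_growth_doubling_at_scale (f : ℝ → ℝ)
    (hf : ∀ t : ℝ, 1 ≤ t → 0 ≤ f t)
    (C d : ℝ) (hC : 0 < C) (hd : 0 ≤ d)
    (hpoly : ∀ t : ℝ, 1 ≤ t → f t ≤ C * t ^ d) :
    ∀ N : ℝ, 1 ≤ N → ∃ M : ℝ, N ≤ M ∧ f (2 * M) ≤ (2 ^ d + 1) * f M := by
  intro N hN
  by_contra! h
  have hq : (0 : ℝ) < 2 ^ d := by positivity
  have ha : 1 ≤ 2 * N := by linarith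
  have hfa : 0 < f (2 * N) :=
    (mul_nonneg (by positivity) (hf N hN)).trans_lt (h N le_rfl)
  obtain ⟨k, hk⟩ := pow_unbounded_of_one_lt (C * (2 * N) ^ d / f (2 * N))
    (show 1 < ((2 : ℝ) ^ d + 1) / 2 ^ d by rw [one_lt_div hq]; linarith)
  rw [div_pow, div_lt_div_iff₀ hfa (by positivity)] at hk
  have hlower := pow_mul_le_of_doubling_lower_bound (a := 2 * N) (by positivity) (by linarith)
    (fun t ht => (h t (by linarith)).le) k
  have hupper := hpoly (2 ^ k * (2 * N)) (one_le_mul_of_one_le_of_one_le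
    (one_le_pow₀ one_le_two) ha)
  have hpow : ((2 : ℝ) ^ k) ^ d = (2 ^ d) ^ k := by
    rw [← Real.rpow_natCast_mul zero_le_two, mul_comm, Real.rpow_mul_natCast zero_le_two]
  rw [Real.mul_rpow (by positivity) (by linarith), hpow] at hupper
  linarith
end

section
/- Let Γ be a group with a finite symmetric generating set S, and suppose there exist constants C > 0 and d ≥ 0 such that the word balls satisfy |B(n)| ≤ C·n^d for all n ≥ 1. Then for every natural number N ≥ 1 there exists a natural number M ≥ N such that |B(2M)| ≤ (2^d + 1)·|B(M)|. -/
/-- The word ball of radius `n` with respect to a generating set `S`: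
elements expressible as a product of at most `n` elements of `S` (so `B 0 = {1}`). -/
def wordBall {Γ : Type*} [Group Γ] (S : Set Γ) (n : ℕ) : Set Γ :=
  {g : Γ | ∃ l : List Γ, (∀ x ∈ l, x ∈ S) ∧ l.length ≤ n ∧ l.prod = g}

open scoped Pointwise in
theorem wordBall_finite {Γ : Type*} [Group Γ] {S : Set Γ} (hS : S.Finite) (n : ℕ) :
    (wordBall S n).Finite := by
  induction n with
  | zero =>
    refine (Set.finite_singleton (1 : Γ)).subset ?_
    rintro g ⟨l, -, hlen, rfl⟩
    simp [List.length_eq_zero_iff.mp (Nat.le_zero.mp hlen)]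
  | succ n ih =>
    refine ((Set.finite_singleton (1 : Γ)).union (hS.mul ih)).subset ?_
    rintro g ⟨_ | ⟨x, l⟩, hl, hlen, rfl⟩
    · simp
    · right
      rw [List.prod_cons]
      exact Set.mul_mem_mul (hl x (by simp))
        ⟨l, fun y hy => hl y (by simp [hy]), by simpa using hlen, rfl⟩

theorem one_mem_wordBall {Γ : Type*} [Group Γ] (S : Set Γ) (n : ℕ) : (1 : Γ) ∈ wordBall S n :=
  ⟨[], by simp⟩

/-- A function bounded by `C * n ^ d` that is positive at `N` cannot grow by a factor greater
than `2 ^ d` at every doubling of scale beyond `N`. -/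
theorem exists_doubling_le_of_le_mul_rpow {f : ℕ → ℝ} {C d K : ℝ} (hK : 2 ^ d < K)
    (hf : ∀ n : ℕ, 1 ≤ n → f n ≤ C * (n : ℝ) ^ d) {N : ℕ} (hN : 1 ≤ N) (hpos : 0 < f N) :
    ∃ M : ℕ, N ≤ M ∧ f (2 * M) ≤ K * f M := by
  by_contra! h
  have h2 : (0 : ℝ) < 2 ^ d := by positivity
  have hlower : ∀ k : ℕ, K ^ k * f N ≤ f (2 ^ k * N) := by
    intro k
    induction k with
    | zero => simp
    | succ k ih =>
      calc K ^ (k + 1) * f N = K * (K ^ k * f N) := by ring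
        _ ≤ K * f (2 ^ k * N) := mul_le_mul_of_nonneg_left ih (h2.trans hK).le
        _ ≤ f (2 * (2 ^ k * N)) := (h _ (Nat.le_mul_of_pos_left N (by positivity))).le
        _ = f (2 ^ (k + 1) * N) := by ring_nf
  obtain ⟨k, hk⟩ := pow_unbounded_of_one_lt (C * (N : ℝ) ^ d / f N) ((one_lt_div h2).mpr hK)
  have hupper := (hlower k).trans (hf (2 ^ k * N) (Nat.mul_pos (by positivity) hN))
  have hpow : ((2 ^ k * N : ℕ) : ℝ) ^ d = (2 ^ d) ^ k * (N : ℝ) ^ d := by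
    push_cast
    rw [Real.mul_rpow (by positivity) (by positivity), Real.rpow_pow_comm (by norm_num)]
  rw [hpow] at hupper
  rw [div_pow, div_lt_div_iff₀ hpos (by positivity)] at hk
  linarith

/-- A group of polynomial growth has doubling at arbitrarily large scales. -/
theorem group_polynomial_growth_doubling_at_scale {Γ : Type*} [Group Γ]
    (S : Set Γ) (hfin : S.Finite) (hsym : S⁻¹ = S) (hgen : Subgroup.closure S = ⊤)
    (C d : ℝ) (hC : 0 < C) (hd : 0 ≤ d)
    (hpoly : ∀ n : ℕ, 1 ≤ n → ((wordBall S n).ncard : ℝ) ≤ C * (n : ℝ) ^ d) :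
    ∀ N : ℕ, 1 ≤ N → ∃ M : ℕ, N ≤ M ∧
      ((wordBall S (2 * M)).ncard : ℝ) ≤ (2 ^ d + 1) * ((wordBall S M).ncard : ℝ) := by
  intro N hN
  have hpos : 0 < (wordBall S N).ncard :=
    (Set.ncard_pos (wordBall_finite hfin N)).mpr ⟨1, one_mem_wordBall S N⟩
  exact exists_doubling_le_of_le_mul_rpow (f := fun n => ((wordBall S n).ncard : ℝ))
    (lt_add_one _) hpoly hN (Nat.cast_pos.mpr hpos)
end

section
/- Let Γ be a group acting by homeomorphisms on a compact metrizable space X whose topology is induced by a metric d. Let A ⊆ X be closed and B ⊆ X open, and assume every point of A lies in the Γ-orbit of a point of B. Let m ≥ 1 be a natural number, D ⊆ Γ a finite subset, and ε > 0, and suppose that for every x ∈ X one has |{g ∈ D⁻¹D : g·x ∈ A^ε}| < m·|{g ∈ D : g·x ∈ B^{−ε}}|, where D⁻¹D = {h⁻¹k : h, k ∈ D}. Then A ≼_{m−1} B. -/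
open Pointwise

/-- `ε`-thickening `Y^ε = {x : d(x, y) < ε for some y ∈ Y}`. -/
def thick {X : Type*} [MetricSpace X] (Y : Set X) (ε : ℝ) : Set X :=
  {x : X | ∃ y ∈ Y, dist x y < ε}

/-- `ε`-shrinking `Y^{-ε} = {x : d(x, z) > ε for every z ∈ X \ Y}`. -/
def shrink {X : Type*} [MetricSpace X] (Y : Set X) (ε : ℝ) : Set X :=
  {x : X | ∀ z ∉ Y, ε < dist x z}

/-- `A ≼_m B`: there are finitely many open sets `U j` covering `A`, group elements `g j`
with `g j • U j ⊆ B`, and a colouring `c` with `m + 1` colours such that translates of the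
same colour are disjoint. -/
def SubEquiv (Γ : Type*) {X : Type*} [Group Γ] [MulAction Γ X] [TopologicalSpace X]
    (A B : Set X) (m : ℕ) : Prop :=
  ∃ (N : ℕ) (U : Fin N → Set X) (g : Fin N → Γ) (c : Fin N → Fin (m + 1)),
    (∀ j, IsOpen (U j)) ∧ (A ⊆ ⋃ j, U j) ∧ (∀ j, g j • U j ⊆ B) ∧
    ∀ j k, j ≠ k → c j = c k → Disjoint (g j • U j) (g k • U k)

open Metric in
/-- Greedy choice of open sets: `greedySet A B s g c i` consists of the points within `s i` of the
part of `A` not covered at earlier stages, which `g i` moves into `B` and further than `s i` from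
the translates of the earlier sets of the same colour. -/
def greedySet {Γ X C : Type*} [Group Γ] [MetricSpace X] [MulAction Γ X] (A B : Set X) (s : ℕ → ℝ)
    {N : ℕ} (g : Fin N → Γ) (c : Fin N → C) (i : Fin N) : Set X :=
  thickening (s i) (A \ ⋃ k : {k : Fin N // k < i}, greedySet A B s g c k.1) ∩
    ((fun x => g i • x) ⁻¹' B ∩
      ⋂ k : {k : Fin N // k < i}, {x | c k.1 = c i →
        g i • x ∉ cthickening (s i) (g k.1 • greedySet A B s g c k.1)})
termination_by i
decreasing_by all_goals exact k.2

section greedySet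

variable {Γ X C : Type*} [Group Γ] [MetricSpace X] [MulAction Γ X] {A B : Set X} {s : ℕ → ℝ}
  {N : ℕ} {g : Fin N → Γ} {c : Fin N → C}

open Metric in
lemma mem_greedySet {i : Fin N} {x : X} :
    x ∈ greedySet A B s g c i ↔
      x ∈ thickening (s i) (A \ ⋃ k : {k : Fin N // k < i}, greedySet A B s g c k.1) ∧
      g i • x ∈ B ∧ ∀ k < i, c k = c i →
        g i • x ∉ cthickening (s i) (g k • greedySet A B s g c k) := by
  rw [greedySet]
  simp

lemma isOpen_greedySet (hcont : ∀ g : Γ, Continuous fun x : X => g • x) (hB : IsOpen B)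
    (i : Fin N) : IsOpen (greedySet A B s g c i) := by
  rw [greedySet]
  refine Metric.isOpen_thickening.inter ((hB.preimage (hcont _)).inter
    (isOpen_iInter_of_finite fun k => ?_))
  by_cases h : c k.1 = c i
  · simp only [h, true_imp_iff]
    exact (Metric.isClosed_cthickening.preimage (hcont (g i))).isOpen_compl
  · simp [h]

lemma smul_greedySet_subset (i : Fin N) : g i • greedySet A B s g c i ⊆ B := by
  rintro _ ⟨x, hx, rfl⟩
  exact (mem_greedySet.1 hx).2.1

lemma disjoint_smul_greedySet {i j : Fin N} (hij : i ≠ j) (hc : c i = c j) :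
    Disjoint (g i • greedySet A B s g c i) (g j • greedySet A B s g c j) := by
  wlog h : i < j generalizing i j
  · exact (this hij.symm hc.symm (lt_of_le_of_ne (not_lt.1 h) hij.symm)).symm
  rw [Set.disjoint_right]
  rintro _ ⟨x, hx, rfl⟩ hxi
  exact (mem_greedySet.1 hx).2.2 i h hc (Metric.self_subset_cthickening _ hxi)

/-- A point of `A` missed by all greedy sets is blocked at each stage `i` that would move it
into `B`, by an earlier set of the same colour. -/
lemma exists_near_of_notMem_greedySet (hs : ∀ n, 0 < s n) (hanti : Antitone s) {x : X}
    (hxA : x ∈ A) (hx : ∀ i, x ∉ greedySet A B s g c i) (i : Fin N) (hi : g i • x ∈ B) :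
    ∃ k, c k = c i ∧
      ∃ u ∈ greedySet A B s g c k, dist (g i • x) (g k • u) < 3 * s (k + 1) := by
  have h := hx i
  rw [mem_greedySet] at h
  push Not at h
  obtain ⟨k, hk, hc, hmem⟩ := h (Metric.self_subset_thickening (hs i) _
    ⟨hxA, by simpa using fun k _ => hx k⟩) hi
  have hlt : s i < 3 * s (k + 1) := by
    have := hanti (Nat.succ_le_of_lt hk : (k : ℕ) + 1 ≤ i)
    linarith [hs i]
  obtain ⟨_, ⟨u, hu, rfl⟩, hd⟩ := Metric.mem_thickening_iff.1
    (Metric.cthickening_subset_thickening' (by linarith [hs i]) hlt _ hmem)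
  exact ⟨k, hc, u, hu, hd⟩

/-- If `g j • a` is close to the translate of the `j`-th greedy set, then `a` is close to a point
of `A` missed by all the earlier sets. -/
lemma exists_mem_diff_dist_lt {F : Set Γ}
    (hunif : ∀ n, ∀ h ∈ F, ∀ u v : X, dist u v < 3 * s (n + 1) → dist (h • u) (h • v) < s n)
    {j : Fin N} (hj : (g j)⁻¹ ∈ F) {a u : X} (hu : u ∈ greedySet A B s g c j)
    (hd : dist (g j • a) (g j • u) < 3 * s (j + 1)) :
    ∃ r ∈ A, (∀ k < j, r ∉ greedySet A B s g c k) ∧ dist a r < 2 * s j := by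
  have hau : dist a u < s j := by simpa using hunif j _ hj _ _ hd
  obtain ⟨r, ⟨hrA, hr⟩, hur⟩ := Metric.mem_thickening_iff.1 (mem_greedySet.1 hu).1
  refine ⟨r, hrA, by simpa using hr, ?_⟩
  linarith [dist_triangle a u r]

/-- A point `a` cannot be close to the `j`-th greedy set while, at an earlier stage `l`, its
translate is deep inside `B` and away from the earlier sets of the same colour. -/
lemma not_near_of_lt {F : Set Γ} {ε : ℝ} (hs : ∀ n, 0 < s n) (hanti : Antitone s)
    (hsε : ∀ n, s n < ε)
    (hunif : ∀ n, ∀ h ∈ F, ∀ u v : X, dist u v < 3 * s (n + 1) → dist (h • u) (h • v) < s n)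
    {j l : Fin N} (hlj : l < j) (hj : (g j)⁻¹ ∈ F) (hl : g l ∈ F) {a u : X}
    (hlB : g l • a ∈ shrink B ε)
    (hmin : ∀ k < l, c k = c l → ∀ v ∈ greedySet A B s g c k,
      3 * s (k + 1) ≤ dist (g l • a) (g k • v))
    (hu : u ∈ greedySet A B s g c j) : 3 * s (j + 1) ≤ dist (g j • a) (g j • u) := by
  by_contra! hd
  obtain ⟨r, hrA, hr, har⟩ := exists_mem_diff_dist_lt hunif hj hu hd
  have hlr : dist (g l • a) (g l • r) < s l := by
    refine hunif l _ hl _ _ ?_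
    have := hanti (Nat.succ_le_of_lt hlj : (l : ℕ) + 1 ≤ j)
    linarith [hs j]
  have hrl := hr l hlj
  rw [mem_greedySet] at hrl
  push Not at hrl
  have hrB : g l • r ∈ B := by
    by_contra h
    linarith [hlB _ h, hsε l]
  obtain ⟨k, hk, hc, hmem⟩ := hrl (Metric.self_subset_thickening (hs l) _
    ⟨hrA, by simpa using fun k hk => hr k (hk.trans hlj)⟩) hrB
  obtain ⟨_, ⟨v, hv, rfl⟩, hdv⟩ := Metric.mem_thickening_iff.1
    (Metric.cthickening_subset_thickening' (δ₂ := 2 * s l) (by linarith [hs l])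
      (by linarith [hs l]) _ hmem)
  have := hanti (Nat.succ_le_of_lt hk : (k : ℕ) + 1 ≤ l)
  have := hmin k hk hc v hv
  have := dist_triangle (g l • a) (g l • r) (g k • v)
  simp only at hdv
  linarith

end greedySet

/-- A sequence of scales, each controlling the previous one under finitely many translations. -/
lemma exists_scales {Γ X : Type*} [Group Γ] [MetricSpace X] [CompactSpace X] [MulAction Γ X]
    (hcont : ∀ g : Γ, Continuous fun x : X => g • x) {F : Set Γ} (hF : F.Finite)
    {ε : ℝ} (hε : 0 < ε) :
    ∃ s : ℕ → ℝ, (∀ n, 0 < s n) ∧ Antitone s ∧ (∀ n, s n < ε) ∧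
      ∀ n, ∀ h ∈ F, ∀ u v : X, dist u v < 3 * s (n + 1) → dist (h • u) (h • v) < s n := by
  have step : ∀ t : ℝ, 0 < t → ∃ r : ℝ, 0 < r ∧ r ≤ t ∧
      ∀ h ∈ F, ∀ u v : X, dist u v < 3 * r → dist (h • u) (h • v) < t := by
    intro t ht
    have hev : ∀ᶠ r : ℝ in nhdsWithin 0 (Set.Ioi 0), ∀ h ∈ F, ∀ u v : X,
        dist u v < 3 * r → dist (h • u) (h • v) < t := by
      rw [Filter.eventually_all_finite hF]
      intro h _
      obtain ⟨δ, hδ, H⟩ := Metric.uniformContinuous_iff.1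
        (CompactSpace.uniformContinuous_of_continuous (hcont h)) t ht
      filter_upwards [Ioo_mem_nhdsGT (show (0 : ℝ) < δ / 3 by positivity)] with r hr u v huv
      exact H (by linarith [hr.2])
    obtain ⟨r, hr, hr0, hrt⟩ := (hev.and (Ioc_mem_nhdsGT ht)).exists
    exact ⟨r, hr0, hrt, hr⟩
  choose! f hf0 hfle hf using step
  have hpos : ∀ n, 0 < f^[n] (ε / 2) := by
    intro n
    induction n with
    | zero => simpa using hε
    | succ n ih => rw [Function.iterate_succ_apply']; exact hf0 _ ih
  have hanti : Antitone fun n => f^[n] (ε / 2) := by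
    refine antitone_nat_of_succ_le fun n => ?_
    rw [Function.iterate_succ_apply']
    exact hfle _ (hpos n)
  refine ⟨fun n => f^[n] (ε / 2), hpos, hanti, fun n => ?_, fun n => ?_⟩
  · have : f^[n] (ε / 2) ≤ ε / 2 := hanti n.zero_le
    linarith
  · simp only [Function.iterate_succ_apply']
    exact hf _ (hpos n)

/-- The counting criterion for `(m-1)`-subequivalence (Lemma 4.6 of the
paper, for a transformation groupoid). -/
theorem subequiv_of_counting {Γ : Type*} [Group Γ] {X : Type*} [MetricSpace X]
    [CompactSpace X] [MulAction Γ X] (hcont : ∀ g : Γ, Continuous fun x : X => g • x)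
    (A B : Set X) (hA : IsClosed A) (hB : IsOpen B)
    (horb : ∀ x ∈ A, ∃ g : Γ, ∃ b ∈ B, g • b = x)
    (m : ℕ) (hm : 1 ≤ m) (D : Set Γ) (hD : D.Finite) (ε : ℝ) (hε : 0 < ε)
    (hcount : ∀ x : X,
      {g : Γ | g ∈ D⁻¹ * D ∧ g • x ∈ thick A ε}.ncard <
        m * {g : Γ | g ∈ D ∧ g • x ∈ shrink B ε}.ncard) :
    SubEquiv Γ A B (m - 1) := by
  obtain ⟨m, rfl⟩ := Nat.exists_eq_add_of_le' hm
  rw [Nat.add_sub_cancel]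
  obtain ⟨s, hs, hanti, hsε, hunif⟩ := exists_scales hcont (hD.union hD.inv) (half_pos hε)
  have hsε' : ∀ n, s n < ε := fun n => (hsε n).trans (half_lt_self hε)
  have := hD.to_subtype
  obtain ⟨N, ⟨e⟩⟩ := Finite.exists_equiv_fin (D × Fin (m + 1))
  let g : Fin N → Γ := fun i => (e.symm i).1
  let c : Fin N → Fin (m + 1) := fun i => (e.symm i).2
  have hgF : ∀ i, g i ∈ D ∪ D⁻¹ := fun i => Or.inl (e.symm i).1.2
  have hgF' : ∀ i, (g i)⁻¹ ∈ D ∪ D⁻¹ := fun i => Or.inr (by simp [g])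
  refine ⟨N, greedySet A B s g c, g, c, isOpen_greedySet hcont hB, ?_,
    smul_greedySet_subset, fun j k => disjoint_smul_greedySet⟩
  intro x hxA
  by_contra hx
  simp only [Set.mem_iUnion, not_exists] at hx
  set S : Set Γ := {g : Γ | g ∈ D ∧ g • x ∈ shrink B ε}
  set T : Set Γ := {g : Γ | g ∈ D⁻¹ * D ∧ g • x ∈ thick A ε}
  have key : ∀ p ∈ S ×ˢ (Set.univ : Set (Fin (m + 1))), ∃ h ∈ T, ∃ j : Fin N,
      h = (g j)⁻¹ * p.1 ∧ c j = p.2 ∧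
      (∃ u ∈ greedySet A B s g c j, dist (p.1 • x) (g j • u) < 3 * s (j + 1)) ∧
      ∀ k < j, c k = p.2 → ∀ v ∈ greedySet A B s g c k,
        3 * s (k + 1) ≤ dist (p.1 • x) (g k • v) := by
    rintro ⟨q, d⟩ ⟨⟨hqD, hqB⟩, -⟩
    have hqB' : q • x ∈ B := by
      by_contra h
      have := hqB _ h
      rw [dist_self] at this
      linarith
    let near : Set (Fin N) := {j | c j = d ∧
      ∃ u ∈ greedySet A B s g c j, dist (q • x) (g j • u) < 3 * s (j + 1)}
    have hne : near.Nonempty := by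
      simpa [near, g, c, Set.Nonempty] using
        exists_near_of_notMem_greedySet (g := g) (c := c) hs hanti hxA hx (e (⟨q, hqD⟩, d)) (by simpa [g] using hqB')
    obtain ⟨j, ⟨hjc, u, hu, hd⟩, hmin⟩ := WellFounded.has_min wellFounded_lt near hne
    refine ⟨(g j)⁻¹ * q, ⟨Set.mul_mem_mul (by simp [g]) hqD, ?_⟩, j, rfl, hjc, ⟨u, hu, hd⟩, ?_⟩
    · obtain ⟨r, hrA, -, hr⟩ := exists_mem_diff_dist_lt (a := ((g j)⁻¹ * q) • x) hunif (hgF' j) hu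
        (by simpa [mul_smul] using hd)
      exact ⟨r, hrA, by linarith [hsε j]⟩
    · intro k hk hkc v hv
      by_contra! h
      exact hmin k ⟨hkc, v, hv, h⟩ hk
  choose! φ hφT hφ using key
  have hinj : Set.InjOn φ (S ×ˢ (Set.univ : Set (Fin (m + 1)))) := by
    have aux : ∀ p ∈ S, ∀ q ∈ S, ∀ j l : Fin N, (g j)⁻¹ * p = (g l)⁻¹ * q →
        (∃ u ∈ greedySet A B s g c j, dist (p • x) (g j • u) < 3 * s (j + 1)) →
        (∀ k < l, c k = c l → ∀ v ∈ greedySet A B s g c k,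
          3 * s (k + 1) ≤ dist (q • x) (g k • v)) → ¬ l < j := by
      rintro p hp q hq j l hpq ⟨u, hu, hd⟩ hmin hlj
      have hj : g j • ((g j)⁻¹ * p) • x = p • x := by simp [mul_smul]
      have hl : g l • ((g j)⁻¹ * p) • x = q • x := by rw [hpq]; simp [mul_smul]
      have := not_near_of_lt (a := ((g j)⁻¹ * p) • x) hs hanti hsε' hunif hlj (hgF' j) (hgF l)
        (hl ▸ hq.2) (hl ▸ hmin) hu
      rw [hj] at this
      linarith
    intro p hp q hq hpq
    obtain ⟨j, hj, hjc, hjn, hjm⟩ := hφ p hp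
    obtain ⟨l, hl, hlc, hln, hlm⟩ := hφ q hq
    have h : (g j)⁻¹ * p.1 = (g l)⁻¹ * q.1 := by rw [← hj, ← hl, hpq]
    have hjl : j = l := le_antisymm
      (not_lt.1 (aux _ hp.1 _ hq.1 j l h hjn (by simpa only [hlc] using hlm)))
      (not_lt.1 (aux _ hq.1 _ hp.1 l j h.symm hln (by simpa only [hjc] using hjm)))
    subst hjl
    exact Prod.ext (mul_left_cancel h) (hjc.symm.trans hlc)
  have hle := Set.ncard_le_ncard_of_injOn φ hφT hinj ((hD.inv.mul hD).subset fun _ h => h.1)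
  rw [Set.ncard_prod, Set.ncard_univ, Nat.card_fin, mul_comm] at hle
  exact (hcount x).not_ge hle
end

section
/- Let Γ be a countable group acting minimally by homeomorphisms on a compact metrizable totally disconnected space X, and assume there exists at least one Γ-invariant Borel probability measure on X. Suppose the action has weak m-comparison for some m ∈ ℕ. Then for all clopen subsets A, B ⊆ X such that μ(A) < μ(B) for every Γ-invariant Borel probability measure μ, one has A ≼_0 B. -/
open MeasureTheory Pointwise

/-- The action `Γ ↷ X` has weak `m`-comparison: `A ≼_m B` whenever `A` is closed, `B` is
open, every point of `A` lies in the orbit of a point of `B`, and the measures of `A` and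
`B` under invariant Borel probability measures are uniformly separated. -/
def WeakComparison (Γ X : Type*) [Group Γ] [MulAction Γ X] [TopologicalSpace X]
    [MeasurableSpace X] (m : ℕ) : Prop :=
  ∀ A B : Set X, IsClosed A → IsOpen B →
    (∀ x ∈ A, ∃ g : Γ, ∃ b ∈ B, g • b = x) →
    (∃ a b : ℝ, a < b ∧
      ∀ μ : Measure X, IsProbabilityMeasure μ →
        (∀ g : Γ, Measure.map (fun x : X => g • x) μ = μ) →
        (μ A).toReal ≤ a ∧ b ≤ (μ B).toReal) →
    SubEquiv Γ A B m

section SubEquiv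

variable {Γ X : Type*} [Group Γ] [MulAction Γ X] [TopologicalSpace X]

theorem SubEquiv.mono {A A' B B' : Set X} {m : ℕ} (h : SubEquiv Γ A B m) (hA : A' ⊆ A)
    (hB : B ⊆ B') : SubEquiv Γ A' B' m := by
  obtain ⟨N, U, g, c, hU, hAU, hUB, hd⟩ := h
  exact ⟨N, U, g, c, hU, hA.trans hAU, fun j => (hUB j).trans hB, hd⟩

/-- A one-colour subequivalence may be indexed by any finite type. -/
theorem SubEquiv.of_finite {ι : Type*} [Finite ι] {A B : Set X} (U : ι → Set X) (g : ι → Γ)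
    (hU : ∀ j, IsOpen (U j)) (hA : A ⊆ ⋃ j, U j) (hB : ∀ j, g j • U j ⊆ B)
    (hd : ∀ j k, j ≠ k → Disjoint (g j • U j) (g k • U k)) : SubEquiv Γ A B 0 := by
  obtain ⟨N, ⟨e⟩⟩ := Finite.exists_equiv_fin ι
  refine ⟨N, U ∘ e.symm, g ∘ e.symm, fun _ => 0, fun j => hU _, ?_, fun j => hB _, ?_⟩
  · rwa [Function.comp_def, e.symm.surjective.iUnion_comp U]
  · exact fun j k hjk _ => hd _ _ (e.symm.injective.ne hjk)

theorem SubEquiv.smul {U : Set X} (hU : IsOpen U) (g : Γ) : SubEquiv Γ U (g • U) 0 :=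
  .of_finite (ι := Unit) (fun _ => U) (fun _ => g) (fun _ => hU)
    (Set.subset_iUnion (fun _ : Unit => U) ()) (fun _ => subset_rfl)
    (fun _ _ h => (h rfl).elim)

theorem SubEquiv.empty (B : Set X) : SubEquiv Γ ∅ B 0 :=
  .of_finite (ι := Empty) (fun _ => ∅) (fun _ => 1) (fun _ => isOpen_empty)
    (Set.empty_subset _) (fun j => j.elim) (fun j => j.elim)

theorem SubEquiv.union {A A' B B' : Set X} (h : SubEquiv Γ A B 0) (h' : SubEquiv Γ A' B' 0)
    (hBB' : Disjoint B B') : SubEquiv Γ (A ∪ A') (B ∪ B') 0 := by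
  obtain ⟨N, U, g, c, hU, hAU, hUB, hd⟩ := h
  obtain ⟨N', U', g', c', hU', hAU', hUB', hd'⟩ := h'
  refine .of_finite (ι := Fin N ⊕ Fin N') (Sum.elim U U') (Sum.elim g g') ?_ ?_ ?_ ?_
  · rintro (j | j)
    exacts [hU j, hU' j]
  · rw [Set.iUnion_sum]
    exact Set.union_subset_union hAU hAU'
  · rintro (j | j)
    exacts [(hUB j).trans Set.subset_union_left, (hUB' j).trans Set.subset_union_right]
  · rintro (j | j) (k | k) hjk
    · exact hd j k (fun h => hjk (by rw [h])) (Subsingleton.elim (α := Fin 1) _ _)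
    · exact hBB'.mono (hUB j) (hUB' k)
    · exact (hBB'.mono (hUB k) (hUB' j)).symm
    · exact hd' j k (fun h => hjk (by rw [h])) (Subsingleton.elim (α := Fin 1) _ _)

/-- The `m + 1` colours of `A ≼_m C` can be absorbed by `m + 1` disjoint translates of `C`. -/
theorem SubEquiv.of_disjoint_smul {A C : Set X} {m : ℕ} (h : SubEquiv Γ A C m)
    (t : Fin (m + 1) → Γ) (ht : Pairwise fun i j => Disjoint (t i • C) (t j • C)) :
    SubEquiv Γ A (⋃ i, t i • C) 0 := by
  obtain ⟨N, U, g, c, hU, hAU, hUC, hd⟩ := h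
  have hsub : ∀ j, (t (c j) * g j) • U j ⊆ t (c j) • C := fun j => by
    rw [mul_smul]
    exact Set.smul_set_mono (hUC j)
  refine .of_finite U (fun j => t (c j) * g j) hU hAU
    (fun j => (hsub j).trans (Set.subset_iUnion (fun i => t i • C) (c j))) fun j k hjk => ?_
  by_cases hc : c j = c k
  · rw [mul_smul, mul_smul, hc, Set.disjoint_smul_set]
    exact hd j k hjk hc
  · exact (ht hc).mono (hsub j) (hsub k)

end SubEquiv

section GreedyRemoval

variable {Γ X : Type*} [Group Γ] [MulAction Γ X] [TopologicalSpace X]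

/-- Successively remove from `A` the points moved into what is left of `B` by `e n`, and
remove their images from `B`. -/
def greedyRemoval (e : ℕ → Γ) (A B : Set X) : ℕ → Set X × Set X
  | 0 => (A, B)
  | n + 1 => ((greedyRemoval e A B n).1 \ (e n)⁻¹ • (greedyRemoval e A B n).2,
      (greedyRemoval e A B n).2 \ e n • (greedyRemoval e A B n).1)

variable [ContinuousConstSMul Γ X]

theorem isClopen_smul_set {s : Set X} (hs : IsClopen s) (g : Γ) : IsClopen (g • s) :=
  ⟨hs.1.smul g, hs.2.smul g⟩

theorem isClopen_greedyRemoval (e : ℕ → Γ) {A B : Set X} (hA : IsClopen A) (hB : IsClopen B)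
    (n : ℕ) : IsClopen (greedyRemoval e A B n).1 ∧ IsClopen (greedyRemoval e A B n).2 := by
  induction n with
  | zero => exact ⟨hA, hB⟩
  | succ n ih =>
    exact ⟨ih.1.diff (isClopen_smul_set ih.2 _), ih.2.diff (isClopen_smul_set ih.1 _)⟩

theorem subEquiv_greedyRemoval (e : ℕ → Γ) {A B : Set X} (hA : IsClopen A) (hB : IsClopen B)
    (n : ℕ) : SubEquiv Γ (A \ (greedyRemoval e A B n).1) (B \ (greedyRemoval e A B n).2) 0 := by
  induction n with
  | zero => simpa [greedyRemoval] using SubEquiv.empty (Γ := Γ) (∅ : Set X)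
  | succ n ih =>
    obtain ⟨hP, hQ⟩ := isClopen_greedyRemoval e hA hB n
    have hQB : (greedyRemoval e A B n).2 ⊆ B := by
      clear ih hP hQ
      induction n with
      | zero => exact subset_rfl
      | succ n ih => exact Set.sdiff_subset.trans ih
    simp only [greedyRemoval]
    set P := (greedyRemoval e A B n).1
    set Q := (greedyRemoval e A B n).2
    have himage : e n • (P ∩ (e n)⁻¹ • Q) = e n • P ∩ Q := by
      rw [Set.smul_set_inter, smul_inv_smul]
    refine (ih.union (.smul (hP.inter (isClopen_smul_set hQ (e n)⁻¹)).2 (e n)) ?_).mono ?_ ?_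
    · rw [himage]
      exact Set.disjoint_sdiff_left.mono_right Set.inter_subset_right
    · intro x hx
      simp only [Set.mem_sdiff, Set.mem_union, Set.mem_inter_iff] at hx ⊢
      tauto
    · rw [himage]
      intro x hx
      simp only [Set.mem_sdiff, Set.mem_union, Set.mem_inter_iff] at hx ⊢
      rcases hx with hx | hx
      · tauto
      · exact ⟨hQB hx.2, by tauto⟩

end GreedyRemoval

theorem SMulInvariantMeasure.cond {Γ X : Type*} [Group Γ] [MulAction Γ X] [MeasurableSpace X]
    {μ : Measure X} [SMulInvariantMeasure Γ X μ] {S : Set X}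
    (hS : MeasurableSet S) (hinv : ∀ g : Γ, (fun x => g • x) ⁻¹' S = S) :
    SMulInvariantMeasure Γ X (ProbabilityTheory.cond μ S) := by
  refine ⟨fun g s hs => ?_⟩
  rw [ProbabilityTheory.cond_apply hS, ProbabilityTheory.cond_apply hS]
  nth_rw 2 [← hinv g]
  rw [← Set.preimage_inter, measure_preimage_smul]

theorem continuous_measureReal_of_isClopen {X : Type*} [TopologicalSpace X]
    [TopologicalSpace.MetrizableSpace X] [MeasurableSpace X] [BorelSpace X] {s : Set X}
    (hs : IsClopen s) :
    Continuous fun μ : ProbabilityMeasure X => (μ : Measure X).real s := by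
  refine NNReal.continuous_coe.comp (continuous_iff_continuousAt.2 fun μ => ?_)
  exact ProbabilityMeasure.tendsto_measure_of_isClopen_of_tendsto Filter.tendsto_id hs

/-- For a minimal action on a compact space, the invariant measures of a nonempty open set are
bounded below. -/
theorem exists_pos_forall_le_measureReal {Γ X : Type*} [Group Γ] [TopologicalSpace X]
    [CompactSpace X] [MeasurableSpace X] [MulAction Γ X] [ContinuousConstSMul Γ X]
    (hmin : ∀ x : X, Dense (MulAction.orbit Γ x)) {C : Set X} (hC : IsOpen C)
    (hne : C.Nonempty) :
    ∃ δ > 0, ∀ μ : Measure X, IsProbabilityMeasure μ → SMulInvariantMeasure Γ X μ →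
      δ ≤ μ.real C := by
  obtain ⟨F, hF⟩ := isCompact_univ.elim_finite_subcover (fun g : Γ => g • C)
    (fun g => hC.smul g) (fun x _ => by
      obtain ⟨_, ⟨g, rfl⟩, hy⟩ := (hmin x).exists_mem_open hC hne
      exact Set.mem_iUnion.2 ⟨g⁻¹, by simpa [Set.mem_smul_set_iff_inv_smul_mem] using hy⟩)
  refine ⟨((F.card : ℝ) + 1)⁻¹, by positivity, fun μ hμ hinv => ?_⟩
  have h : (1 : ℝ) ≤ F.card * μ.real C := calc
    (1 : ℝ) = μ.real Set.univ := by simp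
    _ ≤ μ.real (⋃ g ∈ F, g • C) := measureReal_mono hF (measure_ne_top _ _)
    _ ≤ ∑ g ∈ F, μ.real (g • C) := measureReal_biUnion_finset_le _ _
    _ = F.card * μ.real C := by simp [measureReal_def, measure_smul]
  have h₀ : 0 ≤ μ.real C := measureReal_nonneg
  rw [inv_le_iff_one_le_mul₀ (by positivity)]
  nlinarith

section Measure

variable {Γ X : Type*} [Group Γ] [TopologicalSpace X] [MeasurableSpace X] [BorelSpace X]
  [MulAction Γ X] [ContinuousConstSMul Γ X]

theorem smulInvariantMeasure_iff_forall_map_eq {μ : Measure X} :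
    SMulInvariantMeasure Γ X μ ↔ ∀ g : Γ, Measure.map (fun x : X => g • x) μ = μ := by
  refine ⟨fun _ g => MeasureTheory.map_smul g μ, fun h => ⟨fun g s hs => ?_⟩⟩
  rw [← Measure.map_apply (measurable_const_smul g) hs, h g]

theorem measureReal_greedyRemoval (e : ℕ → Γ) {A B : Set X} (hA : IsClopen A) (hB : IsClopen B)
    (μ : Measure X) [IsFiniteMeasure μ] [SMulInvariantMeasure Γ X μ] (n : ℕ) :
    μ.real (greedyRemoval e A B n).1 - μ.real (greedyRemoval e A B n).2
      = μ.real A - μ.real B := by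
  induction n with
  | zero => rfl
  | succ n ih =>
    obtain ⟨hP, hQ⟩ := isClopen_greedyRemoval e hA hB n
    rw [← ih]
    simp only [greedyRemoval]
    set P := (greedyRemoval e A B n).1
    set Q := (greedyRemoval e A B n).2
    have h₁ := measureReal_sdiff_add_inter (μ := μ) (s := P)
      (isClopen_smul_set hQ (e n)⁻¹).1.measurableSet
    have h₂ := measureReal_sdiff_add_inter (μ := μ) (s := Q)
      (isClopen_smul_set hP (e n)).1.measurableSet
    have h₃ : μ.real (P ∩ (e n)⁻¹ • Q) = μ.real (Q ∩ e n • P) := by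
      rw [measureReal_def, measureReal_def, ← measure_smul μ (e n), Set.smul_set_inter,
        smul_inv_smul, Set.inter_comm]
    linarith

/-- If `A` has smaller measure than `B`, then all of `A` but a set that is null for every
invariant measure can be moved into `B`. -/
theorem exists_antitone_subEquiv_diff [Countable Γ] {A B : Set X}
    (hA : IsClopen A) (hB : IsClopen B)
    (hAB : ∀ μ : Measure X, IsProbabilityMeasure μ → SMulInvariantMeasure Γ X μ →
      μ.real A < μ.real B) :
    ∃ P : ℕ → Set X, (∀ n, IsClopen (P n)) ∧ Antitone P ∧
      (∀ n, SubEquiv Γ (A \ P n) B 0) ∧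
      ∀ μ : Measure X, IsProbabilityMeasure μ → SMulInvariantMeasure Γ X μ →
        μ (⋂ n, P n) = 0 := by
  obtain ⟨e, he⟩ := exists_surjective_nat Γ
  set P := fun n => (greedyRemoval e A B n).1
  set Q := fun n => (greedyRemoval e A B n).2
  have hP : ∀ n, IsClopen (P n) := fun n => (isClopen_greedyRemoval e hA hB n).1
  have hQ : ∀ n, IsClopen (Q n) := fun n => (isClopen_greedyRemoval e hA hB n).2
  have hPanti : Antitone P := antitone_nat_of_succ_le fun n => Set.sdiff_subset
  have hQanti : Antitone Q := antitone_nat_of_succ_le fun n => Set.sdiff_subset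
  refine ⟨P, hP, hPanti,
    fun n => (subEquiv_greedyRemoval e hA hB n).mono subset_rfl Set.sdiff_subset, ?_⟩
  intro μ hμ hinv
  by_contra hne
  set S : Set X := ⋃ g : Γ, g • ⋂ n, P n
  have hSm : MeasurableSet S := .iUnion fun g =>
    ((isClosed_iInter fun n => (hP n).1).smul g).measurableSet
  have hSinv : ∀ g : Γ, (fun x => g • x) ⁻¹' S = S := fun g => by
    ext x
    simp only [S, Set.mem_preimage, Set.mem_iUnion, Set.mem_smul_set_iff_inv_smul_mem]
    constructor
    · rintro ⟨h, hx⟩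
      exact ⟨g⁻¹ * h, by simpa [mul_smul] using hx⟩
    · rintro ⟨h, hx⟩
      exact ⟨g * h, by simpa [mul_smul] using hx⟩
  have hPS : (⋂ n, P n) ⊆ S := by
    simpa using Set.subset_iUnion (fun g : Γ => g • ⋂ n, P n) 1
  have hQS : S ∩ ⋂ n, Q n = ∅ := by
    rw [← Set.disjoint_iff_inter_eq_empty, Set.disjoint_left]
    intro x hxS hxQ
    obtain ⟨g, hg⟩ := Set.mem_iUnion.1 hxS
    obtain ⟨n, rfl⟩ := he g
    rw [Set.mem_smul_set_iff_inv_smul_mem, Set.mem_iInter] at hg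
    rw [Set.mem_iInter] at hxQ
    exact (hg (n + 1)).2 (Set.smul_mem_smul_set (hxQ n))
  have hμS : μ S ≠ 0 := fun h => hne (measure_mono_null hPS h)
  have : IsProbabilityMeasure (ProbabilityTheory.cond μ S) :=
    ProbabilityTheory.cond_isProbabilityMeasure hμS
  have := SMulInvariantMeasure.cond (Γ := Γ) (μ := μ) hSm hSinv
  set ν := ProbabilityTheory.cond μ S
  have hνQ : ν (⋂ n, Q n) = 0 := by
    rw [ProbabilityTheory.cond_apply hSm, hQS, measure_empty, mul_zero]
  have hlim : Filter.Tendsto (fun n => ν.real (Q n)) Filter.atTop (nhds 0) := by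
    have := tendsto_measure_iInter_atTop (μ := ν)
      (fun n => (hQ n).1.measurableSet.nullMeasurableSet) hQanti ⟨0, measure_ne_top _ _⟩
    rw [hνQ] at this
    exact (ENNReal.tendsto_toReal ENNReal.zero_ne_top).comp this
  obtain ⟨n, hn⟩ := (hlim.eventually (gt_mem_nhds
    (sub_pos.2 (hAB ν inferInstance inferInstance)))).exists
  have h := measureReal_greedyRemoval e hA hB ν n
  have : 0 ≤ ν.real (P n) := measureReal_nonneg
  simp only [P, Q] at *
  linarith

section Compactness

variable [CompactSpace X] [TopologicalSpace.MetrizableSpace X]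

variable (Γ X) in
/-- The set of invariant Borel probability measures. -/
def invariantProbabilityMeasures : Set (ProbabilityMeasure X) :=
  {μ | SMulInvariantMeasure Γ X (μ : Measure X)}

variable (Γ X) in
theorem isCompact_invariantProbabilityMeasures :
    IsCompact (invariantProbabilityMeasures Γ X) := by
  refine IsClosed.isCompact ?_
  have : invariantProbabilityMeasures Γ X = ⋂ g : Γ, {μ : ProbabilityMeasure X |
      μ.map (continuous_const_smul g).measurable.aemeasurable = μ} := by
    ext μ
    simp only [invariantProbabilityMeasures, Set.mem_ofPred_eq, Set.mem_iInter,
      smulInvariantMeasure_iff_forall_map_eq]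
    exact forall_congr' fun g =>
      ⟨fun h => Subtype.ext h, fun h => congrArg ProbabilityMeasure.toMeasure h⟩
  rw [this]
  exact isClosed_iInter fun g =>
    isClosed_eq (ProbabilityMeasure.continuous_map (continuous_const_smul g)) continuous_id

/-- A strict inequality between the measures of two clopen sets is uniform over all
invariant measures. -/
theorem exists_pos_forall_measureReal_add_le {A B : Set X} (hA : IsClopen A) (hB : IsClopen B)
    (hAB : ∀ μ : Measure X, IsProbabilityMeasure μ → SMulInvariantMeasure Γ X μ →
      μ.real A < μ.real B) :
    ∃ ε > 0, ∀ μ : Measure X, IsProbabilityMeasure μ → SMulInvariantMeasure Γ X μ →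
      μ.real A + ε ≤ μ.real B := by
  rcases (invariantProbabilityMeasures Γ X).eq_empty_or_nonempty with h | h
  · refine ⟨1, one_pos, fun μ hμ hinv => ?_⟩
    have hmem : (⟨μ, hμ⟩ : ProbabilityMeasure X) ∈ invariantProbabilityMeasures Γ X := hinv
    exact absurd (h ▸ hmem) (Set.notMem_empty _)
  · obtain ⟨μ₀, hμ₀, hmin⟩ := (isCompact_invariantProbabilityMeasures Γ X).exists_isMinOn h
      ((continuous_measureReal_of_isClopen hB).sub
        (continuous_measureReal_of_isClopen hA)).continuousOn
    refine ⟨_, sub_pos.2 (hAB μ₀ inferInstance hμ₀), fun μ hμ hinv => ?_⟩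
    have : (μ₀ : Measure X).real B - (μ₀ : Measure X).real A ≤ μ.real B - μ.real A :=
      isMinOn_iff.1 hmin ⟨μ, hμ⟩ hinv
    linarith

/-- If the intersection of a decreasing sequence of clopen sets is null for every invariant
measure, then the measures of these sets tend to zero uniformly. -/
theorem exists_forall_measureReal_lt {P : ℕ → Set X} (hP : ∀ n, IsClopen (P n))
    (hanti : Antitone P)
    (hnull : ∀ μ : Measure X, IsProbabilityMeasure μ → SMulInvariantMeasure Γ X μ →
      μ (⋂ n, P n) = 0) {δ : ℝ} (hδ : 0 < δ) :
    ∃ n, ∀ μ : Measure X, IsProbabilityMeasure μ → SMulInvariantMeasure Γ X μ →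
      μ.real (P n) < δ := by
  by_contra! hcon
  set K := fun n => invariantProbabilityMeasures Γ X ∩
    {μ : ProbabilityMeasure X | δ ≤ (μ : Measure X).real (P n)}
  have hclosed : ∀ n, IsClosed {μ : ProbabilityMeasure X | δ ≤ (μ : Measure X).real (P n)} :=
    fun n => isClosed_le continuous_const (continuous_measureReal_of_isClopen (hP n))
  have hK : ∀ n, IsCompact (K n) := fun n =>
    (isCompact_invariantProbabilityMeasures Γ X).inter_right (hclosed n)
  obtain ⟨μ, hμ⟩ := IsCompact.nonempty_iInter_of_sequence_nonempty_isCompact_isClosed K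
    (fun n μ hμ => ⟨hμ.1, hμ.2.trans (measureReal_mono (hanti n.le_succ))⟩)
    (fun n => by
      obtain ⟨μ, hμ, hinv, h⟩ := hcon n
      exact ⟨⟨μ, hμ⟩, hinv, h⟩)
    (hK 0) (fun n => (hK n).isClosed)
  rw [Set.mem_iInter] at hμ
  have hlim : Filter.Tendsto (fun n => (μ : Measure X).real (P n)) Filter.atTop (nhds 0) := by
    have := tendsto_measure_iInter_atTop (μ := (μ : Measure X))
      (fun n => (hP n).1.measurableSet.nullMeasurableSet) hanti ⟨0, measure_ne_top _ _⟩
    rw [hnull μ inferInstance (hμ 0).1] at this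
    exact (ENNReal.tendsto_toReal ENNReal.zero_ne_top).comp this
  exact hδ.not_ge (ge_of_tendsto' hlim fun n => (hμ n).2)

end Compactness

end Measure

section Minimal

variable {Γ X : Type*} [Group Γ] [TopologicalSpace X] [CompactSpace X] [T2Space X]
  [MulAction Γ X] [ContinuousConstSMul Γ X]

theorem infinite_orbit_inter_of_minimal [Infinite X]
    (hmin : ∀ x : X, Dense (MulAction.orbit Γ x)) {B : Set X} (hB : IsOpen B)
    (hne : B.Nonempty) (x : X) : (MulAction.orbit Γ x ∩ B).Infinite := by
  intro hfin
  have hBsub : B ⊆ MulAction.orbit Γ x ∩ B := by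
    have := (hmin x).open_subset_closure_inter hB
    rwa [Set.inter_comm, hfin.isClosed.closure_eq] at this
  obtain ⟨b, hb⟩ := hne
  have hbo : IsOpen {b} := by
    have : {b} = B \ (B \ {b}) := by
      rw [Set.sdiff_sdiff_cancel_left (Set.singleton_subset_iff.2 hb)]
    rw [this]
    exact hB.sdiff ((hfin.subset hBsub).subset Set.sdiff_subset).isClosed
  have : DiscreteTopology X := discreteTopology_iff_isOpen_singleton.2 fun y => by
    obtain ⟨_, ⟨g, rfl⟩, hz⟩ := (hmin y).exists_mem_open hbo ⟨b, rfl⟩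
    have hy : {y} = g⁻¹ • ({b} : Set X) := by
      rw [Set.smul_set_singleton, ← Set.mem_singleton_iff.1 hz, inv_smul_smul]
    rw [hy]
    exact hbo.smul _
  exact not_finite_iff_infinite.2 ‹Infinite X› finite_of_compact_of_discrete

/-- An infinite minimal action on a totally disconnected space admits, in each nonempty open
set, arbitrarily many disjoint translates of some nonempty clopen set. -/
theorem exists_isClopen_disjoint_smul [TotallyDisconnectedSpace X] [Infinite X]
    (hmin : ∀ x : X, Dense (MulAction.orbit Γ x)) {B : Set X} (hB : IsOpen B)
    (hne : B.Nonempty) (k : ℕ) :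
    ∃ (C : Set X) (t : Fin k → Γ), IsClopen C ∧ C.Nonempty ∧ (∀ i, t i • C ⊆ B) ∧
      Pairwise fun i j => Disjoint (t i • C) (t j • C) := by
  obtain ⟨x, -⟩ := id hne
  have hinf := infinite_orbit_inter_of_minimal hmin hB hne x
  have := hinf.to_subtype
  let p : Fin k → ↥(MulAction.orbit Γ x ∩ B) := fun i => Infinite.natEmbedding _ i
  have hp : Function.Injective fun i => (p i : X) :=
    Subtype.val_injective.comp ((Infinite.natEmbedding _).injective.comp Fin.val_injective)
  choose t ht using fun i => (p i).2.1
  obtain ⟨V, hV, hVd⟩ := (Set.finite_range fun i => (p i : X)).t2_separation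
  obtain ⟨C, hC, hxC, hCsub⟩ := compact_exists_isClopen_in_isOpen (x := x)
    (U := ⋂ i, (fun y => t i • y) ⁻¹' (V (p i) ∩ B))
    (isOpen_iInter_of_finite fun i => ((hV _).2.inter hB).preimage (continuous_const_smul _))
    (Set.mem_iInter.2 fun i => by
      have hti : t i • x = p i := ht i
      rw [Set.mem_preimage, hti]
      exact ⟨(hV _).1, (p i).2.2⟩)
  have htC : ∀ i, t i • C ⊆ V (p i) ∩ B := fun i =>
    Set.image_subset_iff.2 (hCsub.trans (Set.iInter_subset _ i))
  refine ⟨C, t, hC, ⟨x, hxC⟩, fun i => (htC i).trans Set.inter_subset_right, fun i j hij => ?_⟩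
  exact (hVd ⟨i, rfl⟩ ⟨j, rfl⟩ (hp.ne hij)).mono ((htC i).trans Set.inter_subset_left)
    ((htC j).trans Set.inter_subset_left)

end Minimal

/-- For a minimal action of a countable group on a compact metrizable
totally disconnected space admitting an invariant measure, weak `m`-comparison implies
comparison on clopen sets. -/
theorem weakComparison_implies_comparison {Γ : Type*} [Group Γ] [Countable Γ]
    {X : Type*} [TopologicalSpace X] [CompactSpace X]
    [TopologicalSpace.MetrizableSpace X] [TotallyDisconnectedSpace X]
    [MeasurableSpace X] [BorelSpace X]
    [MulAction Γ X] (hcont : ∀ g : Γ, Continuous fun x : X => g • x)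
    (hmin : ∀ x : X, Dense (MulAction.orbit Γ x))
    (hexists : ∃ μ : Measure X, IsProbabilityMeasure μ ∧
      ∀ g : Γ, Measure.map (fun x : X => g • x) μ = μ)
    (m : ℕ) (hcomp : WeakComparison Γ X m) :
    ∀ A B : Set X, IsClopen A → IsClopen B →
      (∀ μ : Measure X, IsProbabilityMeasure μ →
        (∀ g : Γ, Measure.map (fun x : X => g • x) μ = μ) → μ A < μ B) →
      SubEquiv Γ A B 0 := by
  intro A B hA hB hlt
  have : ContinuousConstSMul Γ X := ⟨hcont⟩
  simp only [← smulInvariantMeasure_iff_forall_map_eq] at hexists hlt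
  have hAB : ∀ μ : Measure X, IsProbabilityMeasure μ → SMulInvariantMeasure Γ X μ →
      μ.real A < μ.real B := fun μ hμ hinv =>
    (ENNReal.toReal_lt_toReal (measure_ne_top _ _) (measure_ne_top _ _)).2 (hlt μ hμ hinv)
  obtain ⟨μ₀, hμ₀, hinv₀⟩ := hexists
  have hBne : B.Nonempty := nonempty_of_measure_ne_zero (hlt μ₀ hμ₀ hinv₀).ne_bot
  rcases finite_or_infinite X with hX | hX
  · obtain ⟨P, hP, hanti, hsub, hnull⟩ := exists_antitone_subEquiv_diff hA hB hAB
    have hempty : ⋂ n, P n = ∅ := by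
      by_contra! hne
      obtain ⟨δ, hδ, h⟩ := exists_pos_forall_le_measureReal hmin
        (isOpen_discrete (⋂ n, P n)) hne
      have := h μ₀ hμ₀ hinv₀
      rw [measureReal_def, hnull μ₀ hμ₀ hinv₀] at this
      exact hδ.not_ge this
    have : ∃ n, P n = ∅ := by
      by_contra! hne
      exact (IsCompact.nonempty_iInter_of_sequence_nonempty_isCompact_isClosed P
        (fun n => hanti n.le_succ) hne (hP 0).1.isCompact fun n => (hP n).1).ne_empty hempty
    obtain ⟨n, hn⟩ := this
    simpa [hn] using hsub n
  obtain ⟨ε, hε, hgap⟩ := exists_pos_forall_measureReal_add_le hA hB hAB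
  obtain ⟨k, hk⟩ := exists_nat_gt ((m + 1 : ℝ) / ε)
  obtain ⟨C, t, hC, hCne, htB, htd⟩ :=
    exists_isClopen_disjoint_smul hmin hB.2 hBne ((m + 1) + k)
  have hCsmall : ∀ μ : Measure X, IsProbabilityMeasure μ → SMulInvariantMeasure Γ X μ →
      (m + 1) * μ.real C < ε := by
    intro μ hμ hinv
    have h : ((m + 1 + k : ℕ) : ℝ) * μ.real C ≤ 1 := calc
      ((m + 1 + k : ℕ) : ℝ) * μ.real C = ∑ i, μ.real (t i • C) := by
        simp [measureReal_def, measure_smul]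
      _ = μ.real (⋃ i, t i • C) := by
        rw [measureReal_iUnion_fintype htd
          fun i => (isClopen_smul_set hC (t i)).1.measurableSet]
      _ ≤ 1 := measureReal_le_one
    have h₀ : 0 ≤ μ.real C := measureReal_nonneg
    rw [div_lt_iff₀ hε] at hk
    push_cast at h
    have hm : (0 : ℝ) ≤ m := m.cast_nonneg
    have hk₀ : (0 : ℝ) ≤ k := k.cast_nonneg
    by_contra! hcon
    have h₁ : (k : ℝ) * ε ≤ k * ((m + 1) * μ.real C) := by gcongr
    have h₂ : (m + 1 : ℝ) * (k * μ.real C) ≤ (m + 1) * 1 := by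
      gcongr
      nlinarith
    nlinarith
  let s : Fin (m + 1) → Γ := fun i => t (Fin.castAdd k i)
  have hsd : Pairwise fun i j => Disjoint (s i • C) (s j • C) := fun i j hij =>
    htd ((Fin.castAdd_injective _ _).ne hij)
  set D := ⋃ i, s i • C
  have hD : IsClopen D := isClopen_iUnion_of_finite fun i => isClopen_smul_set hC (s i)
  have hDB : D ⊆ B := Set.iUnion_subset fun i => htB _
  obtain ⟨P, hP, hanti, hsub, hnull⟩ :=
    exists_antitone_subEquiv_diff (Γ := Γ) hA (hB.diff hD) fun μ hμ hinv => by
      have h₁ : μ.real D ≤ (m + 1) * μ.real C := calc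
        μ.real D ≤ ∑ i, μ.real (s i • C) := measureReal_iUnion_fintype_le _
        _ = (m + 1) * μ.real C := by simp [measureReal_def, measure_smul]
      rw [measureReal_sdiff hDB hD.1.measurableSet]
      linarith [hgap μ hμ hinv, hCsmall μ hμ hinv]
  obtain ⟨δ, hδ, hCδ⟩ := exists_pos_forall_le_measureReal hmin hC.2 hCne
  obtain ⟨n, hn⟩ := exists_forall_measureReal_lt hP hanti hnull (half_pos hδ)
  have hPC : SubEquiv Γ (P n) C m := by
    refine hcomp (P n) C (hP n).1 hC.2 (fun x _ => ?_) ⟨δ / 2, δ, by linarith, ?_⟩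
    · obtain ⟨_, ⟨g, rfl⟩, hy⟩ := (hmin x).exists_mem_open hC.2 hCne
      exact ⟨g⁻¹, _, hy, inv_smul_smul g x⟩
    · intro μ hμ hinv
      rw [← smulInvariantMeasure_iff_forall_map_eq] at hinv
      exact ⟨(hn μ hμ hinv).le, hCδ μ hμ hinv⟩
  refine ((hsub n).union (hPC.of_disjoint_smul s hsd) Set.disjoint_sdiff_left).mono ?_ ?_
  · rw [Set.sdiff_union_self]
    exact Set.subset_union_left
  · rw [Set.sdiff_union_self]
    exact Set.union_subset subset_rfl hDB
end
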